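/- Let Γ be an eulerian superstable graph with B_Γ = {0, 1, 2, b₁(Γ)} and b₁(Γ) ≥ 5, decomposed as an edge-disjoint union of circuits γ₁ ∪ ⋯ ∪ γ_r with r maximal. Then any two circuits γ_i, γ_j share at most one vertex and b₁(γ_i ∪ γ_j) ≤ 2; this leads to a contradiction, so in fact there exists m ∈ B_Γ with 3 < m < b₁(Γ). -/

import Mathlib

/-!
A finite multigraph on vertex type `V` with edge type `E`: each edge has a
(possibly diagonal, i.e. loop) unordered pair of endpoints in `Sym2 V`.
-/
structure Multigraph (V E : Type) where
  ends : E → Sym2 V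

namespace Multigraph

variable {V E : Type} [Fintype V] [Fintype E] [DecidableEq V] [DecidableEq E]
variable (G : Multigraph V E)

/-- Valency of the vertex `v` in the subgraph with edge set `Δ`; a loop counts twice. -/
def deg (Δ : Finset E) (v : V) : ℕ :=
  ∑ e ∈ Δ, (if G.ends e = Sym2.diag v then 2 else if v ∈ G.ends e then 1 else 0)

/-- `Δ` is a cyclic subgraph (even subset of edges): all valencies are even. -/
def IsCyclic (Δ : Finset E) : Prop := ∀ v, Even (G.deg Δ v)

instance (Δ : Finset E) : Decidable (G.IsCyclic Δ) :=
  decidable_of_iff (∀ v, Even (G.deg Δ v)) Iff.rfl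

/-- Vertices of the subgraph generated by the edge set `Δ`. -/
def verts (Δ : Finset E) : Finset V :=
  Finset.univ.filter (fun v => ∃ e ∈ Δ, v ∈ G.ends e)

/-- Adjacency through an edge of `Δ`. -/
def Adj (Δ : Finset E) (v w : V) : Prop := ∃ e ∈ Δ, G.ends e = s(v, w)

/-- Connectedness relation of the subgraph with edge set `Δ`. -/
def Reach (Δ : Finset E) : V → V → Prop := Relation.ReflTransGen (G.Adj Δ)

/-- Number of connected components of the subgraph generated by `Δ`
(only vertices incident to an edge of `Δ` are taken into account). -/
noncomputable def ncomp (Δ : Finset E) : ℕ :=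
  Set.ncard { S : Set V | ∃ v ∈ G.verts Δ, S = {w | G.Reach Δ v w} }

/-- Number of connected components of the spanning subgraph `(V, Δ)`. -/
noncomputable def ncompSpanning (Δ : Finset E) : ℕ :=
  Set.ncard { S : Set V | ∃ v : V, S = {w | G.Reach Δ v w} }

/-- First Betti number `|E(Δ)| - |V(Δ)| + c(Δ)` of the subgraph generated by `Δ`. -/
noncomputable def b1 (Δ : Finset E) : ℤ :=
  (Δ.card : ℤ) - (G.verts Δ).card + G.ncomp Δ

/-- The set of cyclic Betti numbers `B_Γ = {b₁(Δ) | Δ cyclic}`. -/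
noncomputable def B : Set ℤ := { n | ∃ Δ : Finset E, G.IsCyclic Δ ∧ G.b1 Δ = n }

/-- The boundary of an `𝔽₂` 1-chain: an edge is sent to the sum of its endpoints
(so a loop is sent to `0`). -/
def bndFun (x : E → ZMod 2) (v : V) : ZMod 2 :=
  ∑ e : E, x e * (if (G.ends e).IsDiag then 0 else if v ∈ G.ends e then 1 else 0)

/-- The boundary operator as an `𝔽₂`-linear map. -/
def bnd : (E → ZMod 2) →ₗ[ZMod 2] (V → ZMod 2) where
  toFun := G.bndFun
  map_add' x y := by
    funext v
    simp only [bndFun, Pi.add_apply, ← Finset.sum_add_distrib]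
    exact Finset.sum_congr rfl fun e _ => by ring
  map_smul' c x := by
    funext v
    simp only [bndFun, Pi.smul_apply, smul_eq_mul, Finset.mul_sum, RingHom.id_apply]
    exact Finset.sum_congr rfl fun e _ => by ring

/-- The cycle space `𝒞_Γ = ker ∂`. -/
def cycleSpace : Submodule (ZMod 2) (E → ZMod 2) := LinearMap.ker G.bnd

/-- The `𝔽₂` 1-chain associated to a set of edges. -/
def chainOf (Δ : Finset E) : E → ZMod 2 := fun e => if e ∈ Δ then 1 else 0

/-- Chains supported on a subset `E'` of the edges. -/
def supportedOn (E' : Finset E) : Submodule (ZMod 2) (E → ZMod 2) where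
  carrier := {x | ∀ e, e ∉ E' → x e = 0}
  add_mem' := by intro x y hx hy e he; simp [hx e he, hy e he]
  zero_mem' := by intro e he; rfl
  smul_mem' := by intro c x hx e he; simp [hx e he]

/-- The cycle space of the subgraph of `G` with edge set `E'`. -/
def cycleSpaceOn (E' : Finset E) : Submodule (ZMod 2) (E → ZMod 2) :=
  G.cycleSpace ⊓ supportedOn E'

/-- The set of cyclic Betti numbers of the subgraph with edge set `E'`. -/
noncomputable def BOn (E' : Finset E) : Set ℤ :=
  { n | ∃ Δ ⊆ E', G.IsCyclic Δ ∧ G.b1 Δ = n }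

/-- `N` is a separating edge: deleting it increases the number of connected components. -/
def Separating (N : E) : Prop :=
  G.ncompSpanning Finset.univ < G.ncompSpanning (Finset.univ \ {N})

/-- `G` is eulerian: every valency is even. -/
def Eulerian : Prop := ∀ v, Even (G.deg Finset.univ v)

/-- `G` is superstable: every vertex has valency at least `3`, except possibly
a vertex carrying a loop. -/
def Superstable : Prop :=
  ∀ v ∈ G.verts Finset.univ, 3 ≤ G.deg Finset.univ v ∨ ∃ e : E, G.ends e = Sym2.diag v

/-- A circuit: a nonempty connected subgraph all of whose valencies equal `2`. -/
def IsCircuit (Δ : Finset E) : Prop :=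
  Δ.Nonempty ∧ (∀ v ∈ G.verts Δ, G.deg Δ v = 2) ∧
    ∀ v ∈ G.verts Δ, ∀ w ∈ G.verts Δ, G.Reach Δ v w

/-- `G` is connected. -/
def Conn : Prop :=
  ∀ v ∈ G.verts Finset.univ, ∀ w ∈ G.verts Finset.univ, G.Reach Finset.univ v w

/-- The edges of `G` that are not separating. -/
noncomputable def nonSepEdges : Finset E :=
  @Finset.filter _ (fun N => ¬ G.Separating N) (Classical.decPred _) Finset.univ

end Multigraph

namespace Multigraph

section Degrees

variable {V E : Type} [DecidableEq V] (G : Multigraph V E)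

theorem deg_singleton {e : E} {a b : V} (h : G.ends e = s(a, b)) (v : V) :
    G.deg {e} v = (if v = a then 1 else 0) + (if v = b then 1 else 0) := by
  simp only [deg, Finset.sum_singleton, h, Sym2.diag, Sym2.eq_iff, Sym2.mem_iff]
  grind

theorem deg_union [DecidableEq E] {A B : Finset E} (h : Disjoint A B) (v : V) :
    G.deg (A ∪ B) v = G.deg A v + G.deg B v :=
  Finset.sum_union h

theorem deg_sdiff_add [DecidableEq E] {A B : Finset E} (h : A ⊆ B) (v : V) :
    G.deg (B \ A) v + G.deg A v = G.deg B v :=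
  Finset.sum_sdiff h

theorem mem_verts [Fintype V] {Δ : Finset E} {v : V} :
    v ∈ G.verts Δ ↔ ∃ e ∈ Δ, v ∈ G.ends e := by
  simp [verts]

theorem deg_pos_iff [Fintype V] {Δ : Finset E} {v : V} :
    0 < G.deg Δ v ↔ v ∈ G.verts Δ := by
  rw [mem_verts, deg, Finset.sum_pos_iff]
  refine exists_congr fun e => and_congr_right fun _ => ?_
  induction h : G.ends e with | _ a b
  simp only [Sym2.diag, Sym2.eq_iff, Sym2.mem_iff]
  grind

theorem verts_union [Fintype V] [DecidableEq E] (A B : Finset E) :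
    G.verts (A ∪ B) = G.verts A ∪ G.verts B := by
  ext v
  simp only [Finset.mem_union, mem_verts]
  grind

theorem verts_nonempty [Fintype V] {Δ : Finset E} (h : Δ.Nonempty) : (G.verts Δ).Nonempty := by
  obtain ⟨e, he⟩ := h
  induction h : G.ends e with | _ a b
  exact ⟨a, G.mem_verts.2 ⟨e, he, by simp [h]⟩⟩

theorem sum_deg [Fintype V] [DecidableEq E] (Δ : Finset E) :
    ∑ v, G.deg Δ v = 2 * Δ.card := by
  have h (e : E) : ∑ v, G.deg {e} v = 2 := by
    induction h : G.ends e with | _ a b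
    simp [G.deg_singleton h, Finset.sum_add_distrib]
  simp only [deg, Finset.sum_singleton] at h ⊢
  rw [Finset.sum_comm, Finset.sum_congr rfl fun e _ => h e]
  simp [mul_comm]

theorem IsCyclic.union [DecidableEq E] {A B : Finset E} (hA : G.IsCyclic A)
    (hB : G.IsCyclic B) (h : Disjoint A B) : G.IsCyclic (A ∪ B) := fun v => by
  rw [G.deg_union h]
  exact (hA v).add (hB v)

theorem even_deg_symmDiff [DecidableEq E] (A B : Finset E) (v : V) :
    Even (G.deg (symmDiff A B) v) ↔ Even (G.deg A v + G.deg B v) := by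
  have h₁ := G.deg_sdiff_add (Finset.inter_subset_left : A ∩ B ⊆ A) v
  have h₂ := G.deg_sdiff_add (Finset.inter_subset_right : A ∩ B ⊆ B) v
  rw [Finset.sdiff_inter_self_left] at h₁
  rw [Finset.sdiff_inter_self_right] at h₂
  have h₃ : G.deg (symmDiff A B) v = G.deg (A \ B) v + G.deg (B \ A) v :=
    G.deg_union disjoint_sdiff_sdiff v
  grind

end Degrees

section Reachability

variable {V E : Type} (G : Multigraph V E)

theorem Reach.symm {Δ : Finset E} {v w : V} (h : G.Reach Δ v w) : G.Reach Δ w v := by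
  induction h with
  | refl => exact .refl
  | tail _ h ih =>
    obtain ⟨e, he, h⟩ := h
    exact .head ⟨e, he, h.trans Sym2.eq_swap⟩ ih

theorem Reach.mono {A B : Finset E} (hAB : A ⊆ B) {v w : V} (h : G.Reach A v w) :
    G.Reach B v w :=
  Relation.ReflTransGen.mono (fun _ _ ⟨e, he, h⟩ => ⟨e, hAB he, h⟩) _ _ h

theorem Reach.comp_eq {Δ : Finset E} {v w : V} (h : G.Reach Δ v w) :
    {x | G.Reach Δ v x} = {x | G.Reach Δ w x} := by
  ext x
  exact ⟨fun hx => (Reach.symm G h).trans hx, fun hx => h.trans hx⟩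

theorem Reach.mem_of_closed {Δ : Finset E} {S : Set V} {v w : V} (h : G.Reach Δ v w)
    (hS : ∀ x ∈ S, ∀ y, G.Adj Δ x y → y ∈ S) (hv : v ∈ S) : w ∈ S := by
  induction h with
  | refl => exact hv
  | tail _ h ih => exact hS _ ih _ h

/-- Two vertices joined by edges of `Δ` are the boundary mod `2` of some subset of `Δ`. -/
theorem Reach.exists_boundary [DecidableEq V] [DecidableEq E] {Δ : Finset E} {v w : V}
    (h : G.Reach Δ v w) : ∃ P ⊆ Δ, ∀ x,
      Even (G.deg P x + ((if x = v then 1 else 0) + (if x = w then 1 else 0))) := by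
  induction h with
  | refl => exact ⟨∅, by simp, fun x => by simp [deg]⟩
  | tail _ h ih =>
    obtain ⟨P, hP, hev⟩ := ih
    obtain ⟨e, he, hends⟩ := h
    refine ⟨symmDiff P {e}, ?_, fun x => ?_⟩
    · intro f hf
      simp only [Finset.mem_symmDiff, Finset.mem_singleton] at hf
      grind
    · have h₁ := G.even_deg_symmDiff P {e} x
      have h₂ := G.deg_singleton hends x
      have h₃ := hev x
      simp only [Nat.even_add] at *
      grind

end Reachability

section Components

variable {V E : Type} [Fintype V] [DecidableEq V] (G : Multigraph V E)

theorem ncomp_pos {Δ : Finset E} (h : Δ.Nonempty) : 1 ≤ G.ncomp Δ := by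
  obtain ⟨v, hv⟩ := G.verts_nonempty h
  exact (Set.ncard_pos (Set.toFinite _)).2 ⟨_, v, hv, rfl⟩

theorem ncomp_le_two {Δ : Finset E} (a b : V)
    (h : ∀ v ∈ G.verts Δ, G.Reach Δ v a ∨ G.Reach Δ v b) : G.ncomp Δ ≤ 2 := by
  refine (Set.ncard_le_ncard (t := {{w | G.Reach Δ a w}, {w | G.Reach Δ b w}}) ?_
    (Set.toFinite _)).trans (Set.ncard_insert_le _ _ |>.trans (by simp))
  rintro _ ⟨v, hv, rfl⟩
  exact (h v hv).imp (Reach.comp_eq G) (Reach.comp_eq G)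

theorem b1_empty : G.b1 ∅ = 0 := by
  simp [b1, ncomp, verts]

variable {G} in
theorem IsCircuit.isCyclic {γ : Finset E} (h : G.IsCircuit γ) : G.IsCyclic γ := fun v => by
  by_cases hv : v ∈ G.verts γ
  · simp [h.2.1 v hv]
  · rw [← deg_pos_iff] at hv
    simp [Nat.eq_zero_of_not_pos hv]

variable {G} in
theorem IsCircuit.deg_le {γ : Finset E} (h : G.IsCircuit γ) (v : V) : G.deg γ v ≤ 2 := by
  by_cases hv : v ∈ G.verts γ
  · exact (h.2.1 v hv).le
  · rw [← deg_pos_iff] at hv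
    omega

variable {G} in
/-- A set of vertices closed under adjacency and meeting a circuit contains the circuit. -/
theorem IsCircuit.verts_subset {γ : Finset E} (h : G.IsCircuit γ) {S : Finset V} {v : V}
    (hv : v ∈ S) (hvγ : v ∈ G.verts γ) (hS : ∀ e ∈ γ, ∀ x ∈ S, ∀ y, G.ends e = s(x, y) → y ∈ S) :
    G.verts γ ⊆ S := fun w hw =>
  Reach.mem_of_closed G (S := (S : Set V)) (h.2.2 v hvγ w hw)
    (fun x hx y ⟨e, he, hends⟩ => hS e he x hx y hends) hv

variable [DecidableEq E]

variable {G} in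
theorem IsCircuit.card_eq {γ : Finset E} (h : G.IsCircuit γ) :
    γ.card = (G.verts γ).card := by
  have h₁ := G.sum_deg γ
  rw [← Finset.sum_subset (Finset.subset_univ (G.verts γ)), Finset.sum_congr rfl h.2.1] at h₁
  · simp at h₁
    omega
  · intro v _ hv
    rw [← deg_pos_iff] at hv
    omega

theorem ncomp_union_circuit_le {Δ γ : Finset E} (hγ : G.IsCircuit γ) :
    G.ncomp (Δ ∪ γ) ≤ G.ncomp Δ + 1 ∧
      ((G.verts Δ ∩ G.verts γ).Nonempty → G.ncomp (Δ ∪ γ) ≤ G.ncomp Δ) := by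
  let f : Set V → Set V := fun S => {w | ∃ s ∈ S, G.Reach (Δ ∪ γ) s w}
  have hf (v : V) : f {w | G.Reach Δ v w} = {w | G.Reach (Δ ∪ γ) v w} := by
    ext w
    constructor
    · rintro ⟨s, hs, hsw⟩
      exact (Reach.mono G Finset.subset_union_left hs).trans hsw
    · exact fun h => ⟨v, .refl, h⟩
  have hsub (u : V) (hu : u ∈ G.verts γ) :
      {S : Set V | ∃ v ∈ G.verts (Δ ∪ γ), S = {w | G.Reach (Δ ∪ γ) v w}} ⊆
        insert {w | G.Reach (Δ ∪ γ) u w}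
          (f '' {S : Set V | ∃ v ∈ G.verts Δ, S = {w | G.Reach Δ v w}}) := by
    rintro _ ⟨v, hv, rfl⟩
    rw [verts_union, Finset.mem_union] at hv
    rcases hv with hv | hv
    · exact .inr ⟨_, ⟨v, hv, rfl⟩, hf v⟩
    · exact .inl (Reach.comp_eq G (Reach.mono G Finset.subset_union_right (hγ.2.2 v hv u hu)))
  constructor
  · obtain ⟨u, hu⟩ := G.verts_nonempty hγ.1
    refine (Set.ncard_le_ncard (hsub u hu) (Set.toFinite _)).trans
      ((Set.ncard_insert_le _ _).trans ?_)
    exact Nat.add_le_add_right (Set.ncard_image_le (Set.toFinite _)) 1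
  · rintro ⟨u, hu⟩
    rw [Finset.mem_inter] at hu
    have hu' : {w | G.Reach (Δ ∪ γ) u w} ∈
        f '' {S : Set V | ∃ v ∈ G.verts Δ, S = {w | G.Reach Δ v w}} :=
      ⟨_, ⟨u, hu.1, rfl⟩, hf u⟩
    have h := hsub u hu.2
    rw [Set.insert_eq_of_mem hu'] at h
    exact (Set.ncard_le_ncard h (Set.toFinite _)).trans (Set.ncard_image_le (Set.toFinite _))

theorem ncomp_add_one_le {Δ γ : Finset E} (hγ : G.IsCircuit γ) :
    G.ncomp Δ + 1 ≤ G.ncomp (Δ ∪ γ) + (G.verts Δ ∩ G.verts γ).card := by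
  obtain ⟨u, hu⟩ := G.verts_nonempty hγ.1
  set C := {S : Set V | ∃ v ∈ G.verts (Δ ∪ γ), S = {w | G.Reach (Δ ∪ γ) v w}} with hC
  have huC : {w | G.Reach (Δ ∪ γ) u w} ∈ C := ⟨u, by simp [verts_union, hu], rfl⟩
  have hsub : {S : Set V | ∃ v ∈ G.verts Δ, S = {w | G.Reach Δ v w}} ⊆
      ((fun v => {w | G.Reach Δ v w}) '' (G.verts Δ ∩ G.verts γ : Finset V)) ∪
        (C \ {{w | G.Reach (Δ ∪ γ) u w}}) := by
    rintro _ ⟨v, hv, rfl⟩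
    by_cases hx : ∃ x ∈ G.verts γ, G.Reach Δ v x
    · obtain ⟨x, hxγ, hvx⟩ := hx
      refine .inl ⟨x, ?_, (Reach.comp_eq G hvx).symm⟩
      simp only [Finset.coe_inter, Set.mem_inter_iff, Finset.mem_coe]
      refine ⟨?_, hxγ⟩
      rcases Relation.ReflTransGen.cases_tail hvx with rfl | ⟨y, _, e, he, hends⟩
      · exact hv
      · exact G.mem_verts.2 ⟨e, he, by simp [hends]⟩
    · push Not at hx
      have heq : {w | G.Reach Δ v w} = {w | G.Reach (Δ ∪ γ) v w} := by
        ext w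
        refine ⟨Reach.mono G Finset.subset_union_left, fun h => ?_⟩
        refine Reach.mem_of_closed G (S := {w | G.Reach Δ v w}) h ?_ .refl
        rintro x hvx y ⟨e, he, hends⟩
        rcases Finset.mem_union.1 he with he | he
        · exact Relation.ReflTransGen.tail hvx ⟨e, he, hends⟩
        · exact absurd hvx (hx x (G.mem_verts.2 ⟨e, he, by simp [hends]⟩))
      refine .inr ⟨⟨v, by simp [verts_union, hv], heq⟩, fun h => hx u hu ?_⟩
      rw [Set.mem_singleton_iff] at h
      have : u ∈ {w | G.Reach (Δ ∪ γ) u w} := Relation.ReflTransGen.refl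
      rwa [← h] at this
  have h₁ := Set.ncard_le_ncard hsub (Set.toFinite _)
  have h₂ := Set.ncard_union_le
    ((fun v => {w | G.Reach Δ v w}) '' (G.verts Δ ∩ G.verts γ : Finset V))
    (C \ {{w | G.Reach (Δ ∪ γ) u w}})
  have h₃ := Set.ncard_image_le (f := fun v => {w | G.Reach Δ v w})
    (G.verts Δ ∩ G.verts γ).finite_toSet
  rw [Set.ncard_coe_finset] at h₃
  have h₄ := Set.ncard_sdiff_singleton_add_one huC (Set.toFinite _)
  have h₅ : G.ncomp (Δ ∪ γ) = C.ncard := rfl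
  rw [h₅]
  change Set.ncard _ + 1 ≤ _
  omega

theorem b1_union_circuit {Δ γ : Finset E} (hγ : G.IsCircuit γ) (hd : Disjoint Δ γ) :
    G.b1 Δ + 1 ≤ G.b1 (Δ ∪ γ) ∧
      G.b1 (Δ ∪ γ) ≤ G.b1 Δ + max 1 (G.verts Δ ∩ G.verts γ).card := by
  have h₁ := (G.ncomp_union_circuit_le (Δ := Δ) hγ).1
  have h₂ := (G.ncomp_union_circuit_le (Δ := Δ) hγ).2
  have h₃ := G.ncomp_add_one_le (Δ := Δ) hγ
  have h₄ := Finset.card_union_add_card_inter (G.verts Δ) (G.verts γ)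
  have h₅ := hγ.card_eq
  rw [← Finset.card_pos] at h₂
  simp only [b1, Finset.card_union_of_disjoint hd, verts_union]
  push_cast
  omega

variable {G}

theorem IsCircuit.b1_eq {γ : Finset E} (h : G.IsCircuit γ) : G.b1 γ = 1 := by
  have := G.b1_union_circuit h (Finset.disjoint_empty_left γ)
  simp [b1_empty, verts] at this
  omega

theorem IsCircuit.card_inter_add_one_le_b1 {γ γ' : Finset E} (h : G.IsCircuit γ)
    (h' : G.IsCircuit γ') (hd : Disjoint γ γ') :
    ((G.verts γ ∩ G.verts γ').card : ℤ) + 1 ≤ G.b1 (γ ∪ γ') := by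
  have h₁ := Finset.card_union_add_card_inter (G.verts γ) (G.verts γ')
  have h₂ := G.ncomp_pos (h.1.mono (Finset.subset_union_left (s₂ := γ')))
  have h₃ := h.card_eq
  have h₄ := h'.card_eq
  simp only [b1, Finset.card_union_of_disjoint hd, verts_union]
  push_cast
  omega

/-- If a subset `A` of a circuit has valency `2` at a vertex, it contains all edges there. -/
theorem IsCircuit.mem_of_deg_eq_two {γ A : Finset E} (h : G.IsCircuit γ) (hA : A ⊆ γ) {v : V}
    (hv : G.deg A v = 2) {e : E} (he : e ∈ γ) (hve : v ∈ G.ends e) : e ∈ A := by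
  by_contra heA
  have h₁ := G.deg_sdiff_add hA v
  have h₂ := h.deg_le v
  have h₃ : 0 < G.deg (γ \ A) v :=
    G.deg_pos_iff.2 (G.mem_verts.2 ⟨e, Finset.mem_sdiff.2 ⟨he, heA⟩, hve⟩)
  omega

theorem IsCircuit.verts_of_loop {γ : Finset E} (h : G.IsCircuit γ) {e : E} (he : e ∈ γ) {v : V}
    (hends : G.ends e = s(v, v)) : G.verts γ ⊆ {v} := by
  refine h.verts_subset (Finset.mem_singleton_self v)
    (G.mem_verts.2 ⟨e, he, by simp [hends]⟩) fun f hf x hx y hfy => ?_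
  rw [Finset.mem_singleton] at hx
  subst hx
  have := h.mem_of_deg_eq_two (A := {e}) (by simpa) (v := x)
    (by simp [G.deg_singleton hends]) hf (by simp [hfy])
  rw [Finset.mem_singleton] at this
  subst this
  rw [hends] at hfy
  simp only [Sym2.eq_iff] at hfy
  grind

theorem IsCircuit.verts_of_ends_eq {γ : Finset E} (h : G.IsCircuit γ) {e f : E} (he : e ∈ γ)
    (hf : f ∈ γ) (hef : e ≠ f) (hends : G.ends e = G.ends f) : (G.verts γ).card ≤ 2 := by
  induction hab : G.ends e with | _ a b
  have hab' := hends ▸ hab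
  by_cases hne : a = b
  · subst hne
    exact (Finset.card_le_card (h.verts_of_loop he hab)).trans (by simp)
  have hA : ({e, f} : Finset E) ⊆ γ := by grind
  have hdeg (x : V) : G.deg {e, f} x = G.deg {e} x + G.deg {f} x :=
    G.deg_union (Finset.disjoint_singleton.2 hef) x
  refine (Finset.card_le_card (h.verts_subset (S := {a, b}) (v := a) (by simp)
    (G.mem_verts.2 ⟨e, he, by simp [hab]⟩) fun g hg x hx y hgy => ?_)).trans Finset.card_le_two
  have hx2 : G.deg {e, f} x = 2 := by
    rw [hdeg, G.deg_singleton hab, G.deg_singleton hab']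
    simp only [Finset.mem_insert, Finset.mem_singleton] at hx
    grind
  have hgA := h.mem_of_deg_eq_two hA hx2 hg (by simp [hgy])
  have hg' : G.ends g = s(a, b) := by
    simp only [Finset.mem_insert, Finset.mem_singleton] at hgA
    rcases hgA with rfl | rfl <;> assumption
  rw [hg'] at hgy
  simp only [Finset.mem_insert, Finset.mem_singleton, Sym2.eq_iff] at *
  grind

/-- Removing an edge `ab` from a circuit, every vertex is still connected to `a` or `b`. -/
theorem IsCircuit.reach_erase {γ : Finset E} (h : G.IsCircuit γ) {e : E} (he : e ∈ γ) {a b v : V}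
    (hends : G.ends e = s(a, b)) (hv : v ∈ G.verts γ) :
    G.Reach (γ.erase e) v a ∨ G.Reach (γ.erase e) v b := by
  have hr := h.2.2 a (G.mem_verts.2 ⟨e, he, by simp [hends]⟩) v hv
  refine Reach.mem_of_closed G
    (S := {v | G.Reach (γ.erase e) v a ∨ G.Reach (γ.erase e) v b}) hr ?_ (.inl .refl)
  rintro x hx y ⟨f, hf, hfxy⟩
  by_cases hfe : f = e
  · subst hfe
    rw [hends] at hfxy
    have hy : y = a ∨ y = b := by
      have : y ∈ s(a, b) := by simp [hfxy]
      simpa using this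
    rcases hy with rfl | rfl
    · exact .inl .refl
    · exact .inr .refl
  · have hadj : G.Adj (γ.erase e) y x :=
      ⟨f, Finset.mem_erase.2 ⟨hfe, hf⟩, hfxy.trans Sym2.eq_swap⟩
    exact hx.imp (Relation.ReflTransGen.head hadj) (Relation.ReflTransGen.head hadj)

/-- Exchanging an edge of `γ` for an arc of `γ'` with the same endpoints. -/
theorem IsCircuit.card_sdiff_le_two {γ γ' : Finset E} (h : G.IsCircuit γ) (h' : G.IsCircuit γ')
    (hd : Disjoint γ γ') (hverts : G.verts γ = G.verts γ')
    (hB : ∀ Δ ⊆ γ ∪ γ', G.IsCyclic Δ → G.b1 Δ ≤ 2 ∨ G.b1 Δ = G.b1 (γ ∪ γ'))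
    {e : E} (he : e ∈ γ) {a b : V} (hends : G.ends e = s(a, b)) (hab : a ≠ b)
    {P : Finset E} (hP : P ⊆ γ') (hev : ∀ v, Even (G.deg P v + G.deg {e} v)) :
    (γ' \ P).card ≤ 2 := by
  set Δ := γ.erase e ∪ (γ' \ P) with hΔ
  have hdΔ : Disjoint (γ.erase e) (γ' \ P) :=
    hd.mono (Finset.erase_subset _ _) Finset.sdiff_subset
  have hdeg (v : V) : G.deg (γ.erase e) v + G.deg {e} v = G.deg γ v := by
    rw [Finset.erase_eq]
    exact G.deg_sdiff_add (by simpa) v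
  have hcyc : G.IsCyclic Δ := fun v => by
    have h₁ := hdeg v
    have h₂ := G.deg_sdiff_add hP v
    have h₃ := h.isCyclic v
    have h₄ := h'.isCyclic v
    have h₅ := hev v
    rw [hΔ, G.deg_union hdΔ]
    grind
  have hPpos : 0 < P.card := by
    rw [Finset.card_pos, Finset.nonempty_iff_ne_empty]
    rintro rfl
    have := hev a
    rw [G.deg_singleton hends] at this
    simp [hab, deg] at this
  have hvΔ : G.verts Δ = G.verts γ := by
    refine Finset.Subset.antisymm ?_ fun v hv => ?_
    · intro v hv
      obtain ⟨f, hf, hvf⟩ := G.mem_verts.1 hv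
      rcases Finset.mem_union.1 hf with hf | hf
      · exact G.mem_verts.2 ⟨f, Finset.mem_of_mem_erase hf, hvf⟩
      · exact hverts ▸ G.mem_verts.2 ⟨f, (Finset.mem_sdiff.1 hf).1, hvf⟩
    · rw [hΔ, verts_union, Finset.mem_union]
      left
      rw [← deg_pos_iff]
      have h₁ := hdeg v
      rw [h.2.1 v hv, G.deg_singleton hends] at h₁
      grind
  have hc₂ : G.ncomp Δ ≤ 2 := G.ncomp_le_two a b fun v hv =>
    (h.reach_erase he hends (hvΔ ▸ hv)).imp
      (Reach.mono G Finset.subset_union_left) (Reach.mono G Finset.subset_union_left)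
  have hc₁ : 1 ≤ G.ncomp Δ := by
    refine G.ncomp_pos (Finset.nonempty_iff_ne_empty.2 fun h0 => ?_)
    obtain ⟨v, hv⟩ := G.verts_nonempty h.1
    rw [← hvΔ, h0] at hv
    simp [verts] at hv
  have h₁ := h.card_inter_add_one_le_b1 h' hd
  rw [← hverts, Finset.inter_self] at h₁
  have h₂ := h.card_eq
  have h₃ := h'.card_eq
  have h₄ := Finset.card_sdiff_add_card_eq_card hP
  have h₅ := Finset.card_erase_add_one he
  have h₆ : Δ.card = (γ.erase e).card + (γ' \ P).card := Finset.card_union_of_disjoint hdΔ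
  have h₇ := hB Δ (Finset.union_subset_union (Finset.erase_subset _ _) Finset.sdiff_subset) hcyc
  have h₈ : G.b1 Δ = (Δ.card : ℤ) - (G.verts γ).card + G.ncomp Δ := by rw [b1, hvΔ]
  rw [← hverts] at h₃
  omega

/-- Two edge-disjoint circuits through the same vertices, at least four in number, contain a
proper cyclic subgraph with first Betti number at least `3`. -/
theorem IsCircuit.false_of_verts_eq {γ γ' : Finset E} (h : G.IsCircuit γ) (h' : G.IsCircuit γ')
    (hd : Disjoint γ γ') (hverts : G.verts γ = G.verts γ') (hcard : 4 ≤ (G.verts γ).card)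
    (hB : ∀ Δ ⊆ γ ∪ γ', G.IsCyclic Δ → G.b1 Δ ≤ 2 ∨ G.b1 Δ = G.b1 (γ ∪ γ')) : False := by
  have hloop {δ : Finset E} (hδ : G.IsCircuit δ) (hδc : 4 ≤ (G.verts δ).card) {e : E}
      (he : e ∈ δ) {a b : V} (hab : G.ends e = s(a, b)) : a ≠ b := by
    rintro rfl
    have := Finset.card_le_card (hδ.verts_of_loop he hab)
    simp at this
    omega
  have hcard' : 4 ≤ (G.verts γ').card := hverts ▸ hcard
  have h4 : (G.verts γ).card = 4 := by
    obtain ⟨e, he⟩ := h.1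
    induction hab : G.ends e with | _ a b
    have ha : a ∈ G.verts γ := G.mem_verts.2 ⟨e, he, by simp [hab]⟩
    have hb : b ∈ G.verts γ := G.mem_verts.2 ⟨e, he, by simp [hab]⟩
    obtain ⟨P, hP, hev⟩ := Reach.exists_boundary G (h'.2.2 a (hverts ▸ ha) b (hverts ▸ hb))
    simp only [← G.deg_singleton hab] at hev
    have h₁ := h.card_sdiff_le_two h' hd hverts hB he hab (hloop h hcard he hab) hP hev
    have h₂ := h.card_sdiff_le_two h' hd hverts hB he hab (hloop h hcard he hab)
      (P := γ' \ P) Finset.sdiff_subset fun v => by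
        have h₃ := G.deg_sdiff_add hP v
        have h₄ := h'.isCyclic v
        have h₅ := hev v
        grind
    rw [Finset.sdiff_sdiff_eq_self hP] at h₂
    have h₃ := Finset.card_sdiff_add_card_eq_card hP
    have h₄ := h'.card_eq
    rw [← hverts] at h₄
    omega
  have hpar : ∃ e ∈ γ, ∃ f ∈ γ', G.ends e = G.ends f := by
    by_contra! hne
    have hinj {δ : Finset E} (hδ : G.IsCircuit δ) (hδc : 4 ≤ (G.verts δ).card) :
        (δ.image G.ends).card = δ.card := by
      refine Finset.card_image_of_injOn fun e he f hf hef => ?_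
      by_contra hne
      have := hδ.verts_of_ends_eq he hf hne hef
      omega
    have hsub {δ : Finset E} (hδ : G.IsCircuit δ) (hδc : 4 ≤ (G.verts δ).card) :
        δ.image G.ends ⊆ (G.verts δ).offDiag.image (Function.uncurry Sym2.mk) := by
      intro z hz
      obtain ⟨e, he, rfl⟩ := Finset.mem_image.1 hz
      induction hab : G.ends e with | _ a b
      refine Finset.mem_image.2 ⟨(a, b), Finset.mem_offDiag.2 ⟨?_, ?_, hloop hδ hδc he hab⟩, rfl⟩
      · exact G.mem_verts.2 ⟨e, he, by simp [hab]⟩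
      · exact G.mem_verts.2 ⟨e, he, by simp [hab]⟩
    have hdis : Disjoint (γ.image G.ends) (γ'.image G.ends) := by
      rw [Finset.disjoint_left]
      simp only [Finset.mem_image]
      grind
    have h₁ := Finset.card_le_card
      (Finset.union_subset (hsub h hcard) (hverts ▸ hsub h' hcard'))
    rw [Finset.card_union_of_disjoint hdis, hinj h hcard, hinj h' hcard', h.card_eq, h'.card_eq,
      Sym2.card_image_offDiag, ← hverts, h4] at h₁
    simp [Nat.choose] at h₁
  obtain ⟨e, he, f, hf, hef⟩ := hpar
  induction hab : G.ends e with | _ a b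
  have h₁ := h.card_sdiff_le_two h' hd hverts hB he hab (hloop h hcard he hab) (P := {f})
    (by simpa) fun v => by
      rw [G.deg_singleton hab, G.deg_singleton (hef ▸ hab)]
      exact ⟨_, rfl⟩
  have h₂ := Finset.card_sdiff_add_card_eq_card (show {f} ⊆ γ' by simpa)
  have h₃ := h'.card_eq
  simp at h₂
  omega

theorem IsCircuit.verts_subset_of_superstable [Fintype E] (hss : G.Superstable)
    {γ γ' : Finset E} (h : G.IsCircuit γ) (hd : Disjoint γ γ') (hcover : γ ∪ γ' = Finset.univ)
    (hcard : (G.verts γ ∩ G.verts γ').Nonempty) : G.verts γ ⊆ G.verts γ' := by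
  intro v hv
  by_contra hv'
  have hv₀ : G.deg γ' v = 0 := by
    rw [← deg_pos_iff] at hv'
    omega
  obtain h₁ | ⟨e, hloop⟩ := hss v (by rw [← hcover, verts_union]; simp [hv])
  · rw [← hcover, G.deg_union hd, h.2.1 v hv, hv₀] at h₁
    omega
  · have he : e ∈ γ ∪ γ' := hcover ▸ Finset.mem_univ e
    rcases Finset.mem_union.1 he with he | he
    · obtain ⟨w, hw⟩ := hcard
      rw [Finset.mem_inter] at hw
      have := h.verts_of_loop he hloop hw.1
      rw [Finset.mem_singleton] at this
      exact hv' (this ▸ hw.2)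
    · exact hv' (G.mem_verts.2 ⟨e, he, by rw [hloop]; exact Sym2.mem_mk_left v v⟩)

end Components

end Multigraph

/-- For an eulerian superstable graph with `B_Γ = {0,1,2,b₁(Γ)}` and
`b₁(Γ) ≥ 5`, decomposed into a maximal number of pairwise edge-disjoint
circuits: any two circuits share at most one vertex and `b₁(γᵢ ∪ γⱼ) ≤ 2`;
this leads to a contradiction, so there is `m ∈ B_Γ` with `3 < m < b₁(Γ)`. -/
theorem claim_of_theorem_three {V E : Type} [Fintype V] [Fintype E]
    [DecidableEq V] [DecidableEq E] (G : Multigraph V E)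
    (heul : G.Eulerian) (hss : G.Superstable)
    (hB : G.B = {0, 1, 2, G.b1 Finset.univ}) (hb : 5 ≤ G.b1 Finset.univ)
    (r : ℕ) (γ : Fin r → Finset E)
    (hcirc : ∀ i, G.IsCircuit (γ i))
    (hdisj : ∀ i j, i ≠ j → Disjoint (γ i) (γ j))
    (hcover : Finset.univ.biUnion γ = Finset.univ)
    (hmax : ∀ (r' : ℕ) (γ' : Fin r' → Finset E),
      (∀ i, G.IsCircuit (γ' i)) → (∀ i j, i ≠ j → Disjoint (γ' i) (γ' j)) →
      Finset.univ.biUnion γ' = Finset.univ → r' ≤ r) :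
    (∀ i j, i ≠ j →
      (G.verts (γ i) ∩ G.verts (γ j)).card ≤ 1 ∧ G.b1 (γ i ∪ γ j) ≤ 2) ∧
    ∃ m ∈ G.B, 3 < m ∧ m < G.b1 Finset.univ := by
  exfalso
  have hBle {Δ : Finset E} (hΔ : G.IsCyclic Δ) : G.b1 Δ ≤ 2 ∨ G.b1 Δ = G.b1 Finset.univ := by
    have : G.b1 Δ ∈ G.B := ⟨Δ, hΔ, rfl⟩
    rw [hB] at this
    simp only [Set.mem_insert_iff, Set.mem_singleton_iff] at this
    omega
  rcases Nat.lt_or_ge r 3 with hr | hr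
  · interval_cases r
    · simp only [Finset.univ_eq_empty, Finset.biUnion_empty] at hcover
      rw [← hcover, G.b1_empty] at hb
      omega
    · have h : γ 0 = Finset.univ := by simpa using hcover
      have := (hcirc 0).b1_eq
      rw [h] at this
      omega
    · have h : γ 0 ∪ γ 1 = Finset.univ := by simpa [Fin.univ_succ] using hcover
      have hd := hdisj 0 1 (by decide)
      have h₁ := (G.b1_union_circuit (hcirc 1) hd).2
      rw [h, (hcirc 0).b1_eq] at h₁
      have h₂ : 4 ≤ (G.verts (γ 0) ∩ G.verts (γ 1)).card := by omega
      have h₃ : (G.verts (γ 0) ∩ G.verts (γ 1)).Nonempty := Finset.card_pos.1 (by omega)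
      have hverts : G.verts (γ 0) = G.verts (γ 1) :=
        ((hcirc 0).verts_subset_of_superstable hss hd h h₃).antisymm
          ((hcirc 1).verts_subset_of_superstable hss hd.symm ((Finset.union_comm _ _).trans h)
            (by rwa [Finset.inter_comm]))
      rw [← hverts, Finset.inter_self] at h₂
      exact (hcirc 0).false_of_verts_eq (hcirc 1) hd hverts h₂ fun Δ _ hΔ => h ▸ hBle hΔ
  · have key (i j k : Fin r) (hij : i ≠ j) (hik : i ≠ k) (hjk : j ≠ k) :
        G.b1 (γ i ∪ γ j) ≤ 2 ∧ (G.verts (γ i) ∩ G.verts (γ j)).card ≤ 1 ∧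
          5 ≤ G.b1 (γ i ∪ γ j ∪ γ k) := by
      have hd : Disjoint (γ i ∪ γ j) (γ k) :=
        Finset.disjoint_union_left.2 ⟨hdisj i k hik, hdisj j k hjk⟩
      have hc := (hcirc i).isCyclic.union G (hcirc j).isCyclic (hdisj i j hij)
      have h₁ := (G.b1_union_circuit (hcirc j) (hdisj i j hij)).1
      have h₂ := (G.b1_union_circuit (hcirc k) hd).1
      have h₃ := (hcirc i).b1_eq
      have h₄ := (hcirc i).card_inter_add_one_le_b1 (hcirc j) (hdisj i j hij)
      have h₅ := hBle hc
      have h₆ := hBle (hc.union G (hcirc k).isCyclic hd)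
      omega
    let i : Fin r := ⟨0, by omega⟩
    let j : Fin r := ⟨1, by omega⟩
    let k : Fin r := ⟨2, by omega⟩
    have hij : i ≠ j := by simp [i, j]
    have hik : i ≠ k := by simp [i, k]
    have hjk : j ≠ k := by simp [j, k]
    have h₁ := key i j k hij hik hjk
    have h₂ := key i k j hik hij hjk.symm
    have h₃ := key j k i hjk hij.symm hik.symm
    have h₄ := (G.b1_union_circuit (hcirc k)
      (Finset.disjoint_union_left.2 ⟨hdisj i k hik, hdisj j k hjk⟩)).2
    rw [G.verts_union, Finset.union_inter_distrib_right] at h₄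
    have h₅ := Finset.card_union_le (G.verts (γ i) ∩ G.verts (γ k))
      (G.verts (γ j) ∩ G.verts (γ k))
    omega
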